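/- Let m ≥ 1 be a natural number, t > 0 a real number, a an integer, y an element of B_a, and n a natural number large enough that the ball B_{−n}(y) := {z ∈ ℚ_p : |z − y| ≤ p^{−n}} is contained in B_a. Then, with z_0 := 0, the following strict inequality holds: (∫_{B_a} ⋯ ∫_{B_a} ∫_{B_{−n}(y)} ∏_{j=1}^m ρ(t/m, z_j − z_{j−1}) dμ(z_m) dμ(z_{m−1}) ⋯ dμ(z_1)) / (∫_{B_a} ρ(t/m, w) dμ(w))^m > ∫_{B_{−n}(y)} ρ(t, z) dμ(z), where the variables z_1, …, z_{m−1} are integrated over B_a and the last variable z_m over B_{−n}(y). (In probabilistic terms: for a p-adic Brownian path started at 0, the conditional probability that X_t lies in B_{−n}(y), given that the path is in B_a at each of the times t/m, 2t/m, …, t, strictly exceeds the unconditional probability that X_t lies in B_{−n}(y).) -/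

import Mathlib

open MeasureTheory

/-- The fundamental solution `ρ(t,x)` of the p-adic diffusion equation with diffusion
constant `σ` and Vladimirov exponent `b`:
`ρ(t,x) = Σ_{r∈ℤ} (exp(−σ t p^{rb}) − exp(−σ t p^{(r+1)b})) p^r 1_{B_{−r}}(x)`. -/
noncomputable def rho (p : ℕ) [Fact p.Prime] (σ b : ℝ) (t : ℝ) (x : ℚ_[p]) : ℝ :=
  ∑' r : ℤ,
    (Real.exp (-(σ * t * (p : ℝ) ^ ((r : ℝ) * b))) -
      Real.exp (-(σ * t * (p : ℝ) ^ (((r : ℝ) + 1) * b)))) *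
    (p : ℝ) ^ (r : ℤ) *
    Set.indicator {y : ℚ_[p] | ‖y‖ ≤ (p : ℝ) ^ (-r : ℤ)} (fun _ => 1) x

/-- The iterated integral `∫_A ρ(t_1, x_1−x_0) ∫_A ρ(t_2, x_2−x_1) ⋯ ∫_A ρ(t_k, x_k−x_{k−1})
· f(x_k) dμ(x_k) ⋯ dμ(x_1)`, defined by recursion on the list `(t_1,…,t_k)` of time
increments; `f` is the innermost factor and `x0` the starting point. -/
noncomputable def iterInt (p : ℕ) [Fact p.Prime] [MeasurableSpace ℚ_[p]]
    (σ b : ℝ) (μ : MeasureTheory.Measure ℚ_[p]) (A : Set ℚ_[p]) (f : ℚ_[p] → ℝ) :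
    List ℝ → ℚ_[p] → ℝ
  | [], x0 => f x0
  | t :: ts, x0 => ∫ x in A, rho p σ b t (x - x0) * iterInt p σ b μ A f ts x ∂μ

/-- The Fourier multiplier `exp(−σ t p^{rb})` of the diffusion semigroup on the sphere of
radius `p^r`. -/
noncomputable def heatMultiplier (p : ℕ) (σ b t : ℝ) (r : ℤ) : ℝ :=
  Real.exp (-(σ * t * (p : ℝ) ^ ((r : ℝ) * b)))

/-- The normalized indicator function of the ball of radius `p^{-r}` centred at `0`. -/
noncomputable def ballDensity (p : ℕ) [Fact p.Prime] (r : ℤ) (x : ℚ_[p]) : ℝ :=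
  Set.indicator {z : ℚ_[p] | ‖z‖ ≤ (p : ℝ) ^ (-r)} (fun _ => (p : ℝ) ^ r) x

/-- The mass which `ρ(t, ·)` gives to the ball of radius `p^{-r}`, as a convex combination of
the multipliers `exp(−σ t p^{(r-j)b})`. -/
noncomputable def ballMass (p : ℕ) (σ b t : ℝ) (r : ℤ) : ℝ :=
  (1 - (p : ℝ)⁻¹) * ∑' j : ℕ, (p : ℝ)⁻¹ ^ j * heatMultiplier p σ b t (r - j)

section Real

theorem hasSum_real_of_eq {ι : Type*} {f g : ι → ℝ} {a c : ℝ} (h : HasSum f a)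
    (hfg : ∀ i, g i = f i) (hac : c = a) : HasSum g c := by
  rwa [hac, funext hfg]

theorem heatMultiplier_pos {p : ℕ} {σ b t : ℝ} (r : ℤ) : 0 < heatMultiplier p σ b t r :=
  Real.exp_pos _

theorem heatMultiplier_pow {p : ℕ} {σ b t : ℝ} (m : ℕ) (hm : m ≠ 0) (r : ℤ) :
    heatMultiplier p σ b (t / m) r ^ m = heatMultiplier p σ b t r := by
  have : (m : ℝ) ≠ 0 := by exact_mod_cast hm
  rw [heatMultiplier, heatMultiplier, ← Real.exp_nat_mul]
  congr 1
  field_simp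

variable {p : ℕ} [Fact p.Prime] {σ b t : ℝ}

theorem one_lt_prime_cast (p : ℕ) [Fact p.Prime] : (1 : ℝ) < p := by
  exact_mod_cast (Fact.out : p.Prime).one_lt

theorem prime_cast_pos (p : ℕ) [Fact p.Prime] : (0 : ℝ) < p :=
  zero_lt_one.trans (one_lt_prime_cast p)

theorem inv_prime_cast_lt_one (p : ℕ) [Fact p.Prime] : (p : ℝ)⁻¹ < 1 :=
  inv_lt_one_of_one_lt₀ (one_lt_prime_cast p)

theorem heatMultiplier_lt_one (hσ : 0 < σ) (ht : 0 < t) (r : ℤ) :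
    heatMultiplier p σ b t r < 1 := by
  have := prime_cast_pos p
  rw [heatMultiplier, Real.exp_lt_one_iff, neg_lt_zero]
  positivity

theorem heatMultiplier_strictAnti (hσ : 0 < σ) (hb : 0 < b) (ht : 0 < t) :
    StrictAnti (heatMultiplier p σ b t) := by
  intro r s hrs
  have h : (p : ℝ) ^ ((r : ℝ) * b) < (p : ℝ) ^ ((s : ℝ) * b) :=
    Real.rpow_lt_rpow_of_exponent_lt (one_lt_prime_cast p)
      (mul_lt_mul_of_pos_right (by exact_mod_cast hrs) hb)
  exact Real.exp_lt_exp.2 (neg_lt_neg (mul_lt_mul_of_pos_left h (by positivity)))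

theorem tendsto_heatMultiplier (hσ : 0 < σ) (hb : 0 < b) (ht : 0 < t) (r : ℤ) :
    Filter.Tendsto (fun n : ℕ => heatMultiplier p σ b t (r + n)) Filter.atTop (nhds 0) := by
  have h : Filter.Tendsto (fun n : ℕ => (((r + n : ℤ) : ℝ)) * b) Filter.atTop Filter.atTop := by
    refine Filter.Tendsto.atTop_mul_const hb ?_
    push_cast
    exact Filter.tendsto_atTop_add_const_left _ _ tendsto_natCast_atTop_atTop
  exact Real.tendsto_exp_neg_atTop_nhds_zero.comp <|
    ((tendsto_rpow_atTop_of_base_gt_one _ (one_lt_prime_cast p)).comp h).const_mul_atTop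
      (mul_pos hσ ht)

theorem hasSum_heatMultiplier_sub (hσ : 0 < σ) (hb : 0 < b) (ht : 0 < t) (r : ℤ) :
    HasSum (fun n : ℕ => heatMultiplier p σ b t (r + n) - heatMultiplier p σ b t (r + n + 1))
      (heatMultiplier p σ b t r) := by
  rw [hasSum_iff_tendsto_nat_of_nonneg
    fun n => sub_nonneg.2 (heatMultiplier_strictAnti hσ hb ht (lt_add_one _)).le]
  have h (N : ℕ) : ∑ n ∈ Finset.range N,
      (heatMultiplier p σ b t (r + n) - heatMultiplier p σ b t (r + n + 1)) =
        heatMultiplier p σ b t r - heatMultiplier p σ b t (r + N) := by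
    have := Finset.sum_range_sub' (fun n : ℕ => heatMultiplier p σ b t (r + n)) N
    simpa [add_assoc] using this
  simpa [h] using (tendsto_heatMultiplier hσ hb ht r).const_sub (heatMultiplier p σ b t r)

theorem summable_pow_mul_heatMultiplier (hσ : 0 < σ) (ht : 0 < t) (r : ℤ) :
    Summable fun j : ℕ => (p : ℝ)⁻¹ ^ j * heatMultiplier p σ b t (r - j) := by
  have hp := prime_cast_pos p
  refine Summable.of_nonneg_of_le (fun j => ?_) (fun j => ?_)
    (summable_geometric_of_lt_one (by positivity) (inv_prime_cast_lt_one p))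
  · exact mul_nonneg (by positivity) (heatMultiplier_pos _).le
  · exact mul_le_of_le_one_right (by positivity) (heatMultiplier_lt_one hσ ht _).le

theorem ballMass_succ (hσ : 0 < σ) (ht : 0 < t) (r : ℤ) :
    ballMass p σ b t (r + 1) =
      (p : ℝ)⁻¹ * ballMass p σ b t r + (1 - (p : ℝ)⁻¹) * heatMultiplier p σ b t (r + 1) := by
  rw [ballMass, ballMass, (summable_pow_mul_heatMultiplier hσ ht (r + 1)).tsum_eq_zero_add]
  have (j : ℕ) : (p : ℝ)⁻¹ ^ (j + 1) * heatMultiplier p σ b t (r + 1 - (j + 1 : ℕ)) =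
      (p : ℝ)⁻¹ * ((p : ℝ)⁻¹ ^ j * heatMultiplier p σ b t (r - j)) := by
    rw [pow_succ', mul_assoc]
    congr 3
    rw [Nat.cast_succ, add_sub_add_right_eq_sub]
  simp_rw [this, tsum_mul_left]
  simp
  ring

theorem hasSum_ballMass_sub (hσ : 0 < σ) (ht : 0 < t) (r : ℤ) :
    HasSum (fun j : ℕ => (p : ℝ)⁻¹ ^ j *
        (heatMultiplier p σ b t (r - j) - heatMultiplier p σ b t (r - j + 1)))
      (ballMass p σ b t r - heatMultiplier p σ b t (r + 1)) := by
  have hp := inv_prime_cast_lt_one p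
  have h := (summable_pow_mul_heatMultiplier (p := p) (b := b) hσ ht r).hasSum.sub
    (summable_pow_mul_heatMultiplier (p := p) (b := b) hσ ht (r + 1)).hasSum
  have h1 := ballMass_succ (p := p) (b := b) hσ ht r
  refine hasSum_real_of_eq h (fun j => ?_) ?_
  · rw [mul_sub, sub_add_eq_add_sub]
  · rw [ballMass, ballMass] at h1
    rw [ballMass]
    have : (1 - (p : ℝ)⁻¹) ≠ 0 := by linarith
    apply mul_left_cancel₀ this
    linear_combination h1

theorem ballMass_pos (hσ : 0 < σ) (ht : 0 < t) (r : ℤ) : 0 < ballMass p σ b t r := by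
  have hp := prime_cast_pos p
  refine mul_pos (sub_pos.2 (inv_prime_cast_lt_one p)) ?_
  refine (summable_pow_mul_heatMultiplier hσ ht r).tsum_pos (fun j => ?_) 0 ?_
  · exact mul_nonneg (by positivity) (heatMultiplier_pos _).le
  · simpa using heatMultiplier_pos r

theorem hasSum_weights (p : ℕ) [Fact p.Prime] :
    HasSum (fun j : ℕ => (1 - (p : ℝ)⁻¹) * (p : ℝ)⁻¹ ^ j) 1 := by
  have hp := prime_cast_pos p
  have h := (hasSum_geometric_of_lt_one (by positivity) (inv_prime_cast_lt_one p)).mul_left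
    (1 - (p : ℝ)⁻¹)
  rwa [mul_inv_cancel₀ (sub_pos.2 (inv_prime_cast_lt_one p)).ne'] at h

theorem hasSum_ballMass (hσ : 0 < σ) (ht : 0 < t) (r : ℤ) :
    HasSum (fun j : ℕ => (1 - (p : ℝ)⁻¹) * (p : ℝ)⁻¹ ^ j * heatMultiplier p σ b t (r - j))
      (ballMass p σ b t r) := by
  exact hasSum_real_of_eq
    ((summable_pow_mul_heatMultiplier hσ ht r).hasSum.mul_left (1 - (p : ℝ)⁻¹))
    (fun _ => mul_assoc _ _ _) rfl

theorem ballMass_lt_one (hσ : 0 < σ) (ht : 0 < t) (r : ℤ) : ballMass p σ b t r < 1 := by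
  have hp := prime_cast_pos p
  have hq := sub_pos.2 (inv_prime_cast_lt_one p)
  refine hasSum_lt (i := 0) (fun j => ?_) ?_ (hasSum_ballMass hσ ht r) (hasSum_weights p)
  · exact mul_le_of_le_one_right (by positivity) (heatMultiplier_lt_one hσ ht _).le
  · exact mul_lt_of_lt_one_right (by positivity) (heatMultiplier_lt_one hσ ht _)

/-- A secant bound combined with the tangent line of the convex function `x ↦ x⁻ᵐ` at `l`. -/
theorem one_sub_mul_le_of_le_pow {x l e : ℝ} (m : ℕ) (hx : 0 < x) (hx1 : x ≤ 1) (hl : 0 < l)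
    (he : 0 < e) (hex : e ≤ x ^ m) :
    1 - m * (x / l - 1) ≤ l ^ m * (1 + (1 - x ^ m) / e) := by
  have hxm : 0 < x ^ m := by positivity
  have hlx : 0 < l / x := by positivity
  have h1 : 1 + m * (l / x - 1) ≤ (l / x) ^ m := by
    have := one_add_mul_le_pow (a := l / x - 1) (by linarith) m
    simpa using this
  have h2 : 2 ≤ l / x + x / l := by
    have : l / x + x / l - 2 = (l - x) ^ 2 / (x * l) := by field_simp; ring
    have : 0 ≤ (l - x) ^ 2 / (x * l) := by positivity
    linarith
  have h3 : (x ^ m)⁻¹ ≤ 1 + (1 - x ^ m) / e := by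
    have : (1 - x ^ m) / x ^ m ≤ (1 - x ^ m) / e :=
      div_le_div_of_nonneg_left (sub_nonneg.2 (pow_le_one₀ hx.le hx1)) he hex
    have h4 : (1 - x ^ m) / x ^ m = (x ^ m)⁻¹ - 1 := by field_simp
    linarith
  have h5 : (0 : ℝ) ≤ m * (l / x + x / l - 2) := mul_nonneg m.cast_nonneg (by linarith)
  calc 1 - m * (x / l - 1) ≤ 1 + m * (l / x - 1) := by linarith
    _ ≤ (l / x) ^ m := h1
    _ = l ^ m * (x ^ m)⁻¹ := by rw [div_pow, div_eq_mul_inv]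
    _ ≤ _ := mul_le_mul_of_nonneg_left h3 (by positivity)

theorem one_lt_ballMass_pow_mul (hσ : 0 < σ) (hb : 0 < b) (ht : 0 < t) (m : ℕ) (hm : m ≠ 0)
    (r : ℤ) :
    1 < ballMass p σ b (t / m) r ^ m *
      (1 + (1 - ballMass p σ b t r) / heatMultiplier p σ b t (r + 1)) := by
  have hm' : (0 : ℝ) < m := by exact_mod_cast Nat.pos_of_ne_zero hm
  have hs : 0 < t / m := by positivity
  have hl := ballMass_pos (p := p) (b := b) hσ hs r
  have he := heatMultiplier_pos (p := p) (b := b) (σ := σ) (t := t) r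
  have hp := prime_cast_pos p
  have hq := sub_pos.2 (inv_prime_cast_lt_one p)
  set l := ballMass p σ b (t / m) r
  set e := heatMultiplier p σ b t r
  have hw := hasSum_weights p
  have h1 : HasSum (fun j : ℕ => (1 - (p : ℝ)⁻¹) * (p : ℝ)⁻¹ ^ j *
      (1 - m * (heatMultiplier p σ b (t / m) (r - j) / l - 1))) 1 := by
    refine hasSum_real_of_eq ((hw.mul_right (1 + (m : ℝ))).sub
      ((hasSum_ballMass (p := p) (b := b) hσ hs r).mul_right (m / l))) (fun j => ?_) ?_
    · ring
    · change 1 = 1 * (1 + (m : ℝ)) - l * (m / l)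
      field_simp
      ring
  have h2 : HasSum (fun j : ℕ => (1 - (p : ℝ)⁻¹) * (p : ℝ)⁻¹ ^ j *
      (l ^ m * (1 + (1 - heatMultiplier p σ b (t / m) (r - j) ^ m) / e)))
      (l ^ m * (1 + (1 - ballMass p σ b t r) / e)) := by
    refine hasSum_real_of_eq ((hw.mul_right (l ^ m * (1 + 1 / e))).sub
      ((hasSum_ballMass (p := p) (b := b) hσ ht r).mul_right (l ^ m / e))) (fun j => ?_) ?_
    · rw [heatMultiplier_pow m hm]
      ring
    · ring
  have h3 : 1 ≤ l ^ m * (1 + (1 - ballMass p σ b t r) / e) := by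
    refine hasSum_le (fun j => mul_le_mul_of_nonneg_left ?_ (by positivity)) h1 h2
    refine one_sub_mul_le_of_le_pow m (heatMultiplier_pos _) (heatMultiplier_lt_one hσ hs _).le
      hl he ?_
    rw [heatMultiplier_pow m hm]
    exact (heatMultiplier_strictAnti hσ hb ht).antitone (by simp)
  have h4 : (1 - ballMass p σ b t r) / e <
      (1 - ballMass p σ b t r) / heatMultiplier p σ b t (r + 1) :=
    div_lt_div_of_pos_left (sub_pos.2 (ballMass_lt_one hσ ht r)) (heatMultiplier_pos _)
      (heatMultiplier_strictAnti hσ hb ht (lt_add_one r))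
  have h5 : 0 < l ^ m := by positivity
  nlinarith

end Real

section Ball

variable {p : ℕ} [Fact p.Prime]

theorem prime_zpow_le_iff {r s : ℤ} : (p : ℝ) ^ r ≤ (p : ℝ) ^ s ↔ r ≤ s :=
  zpow_le_zpow_iff_right₀ (one_lt_prime_cast p)

theorem norm_sub_le_of_norm_le {x y : ℚ_[p]} {r : ℝ} (hx : ‖x‖ ≤ r) (hy : ‖y‖ ≤ r) :
    ‖x - y‖ ≤ r := by
  rw [sub_eq_add_neg]
  exact (Padic.nonarchimedean x (-y)).trans (max_le hx (by rwa [norm_neg]))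

theorem norm_le_iff_of_norm_sub_le {x y : ℚ_[p]} {r : ℝ} (h : ‖x - y‖ ≤ r) :
    ‖x‖ ≤ r ↔ ‖y‖ ≤ r := by
  refine ⟨fun hx => ?_, fun hy => ?_⟩
  · simpa using norm_sub_le_of_norm_le hx h
  · simpa using norm_sub_le_of_norm_le h (y := -y) (by simpa using hy)

theorem norm_le_prime_zpow_succ_iff (r : ℤ) (x : ℚ_[p]) :
    ‖x‖ ≤ (p : ℝ) ^ (r + 1) ↔
      ∃ i ∈ Finset.range p, ‖x - i * (p : ℚ_[p]) ^ (-(r + 1))‖ ≤ (p : ℝ) ^ r := by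
  have hp := prime_cast_pos p
  have hp0 : (p : ℚ_[p]) ≠ 0 := by exact_mod_cast (Fact.out : p.Prime).ne_zero
  have hc : ‖(p : ℚ_[p]) ^ (-(r + 1))‖ = (p : ℝ) ^ (r + 1) := by simp
  constructor
  · intro hx
    have hu : ‖x * (p : ℚ_[p]) ^ (r + 1)‖ ≤ 1 := by
      rw [norm_mul, Padic.norm_p_zpow, zpow_neg]
      exact mul_inv_le_one_of_le₀ hx (by positivity)
    obtain ⟨i, hi, h⟩ := PadicInt.exists_mem_range (⟨_, hu⟩ : ℤ_[p])
    refine ⟨i, Finset.mem_range.2 hi, ?_⟩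
    rw [IsLocalRing.mem_maximalIdeal, PadicInt.mem_nonunits, PadicInt.norm_def] at h
    have : x - i * (p : ℚ_[p]) ^ (-(r + 1)) =
        (x * (p : ℚ_[p]) ^ (r + 1) - i) * (p : ℚ_[p]) ^ (-(r + 1)) := by
      rw [sub_mul, mul_assoc, ← zpow_add₀ hp0]
      simp
    rw [Padic.norm_le_pow_iff_norm_lt_pow_add_one, this, norm_mul, hc]
    exact mul_lt_of_lt_one_left (by positivity) h
  · rintro ⟨i, -, h⟩
    refine (norm_le_iff_of_norm_sub_le (h.trans (prime_zpow_le_iff.2 (by simp)))).2 ?_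
    rw [norm_mul, hc]
    exact mul_le_of_le_one_left (by positivity) (Padic.norm_int_le_one i)

theorem measure_norm_le_lt_top [MeasurableSpace ℚ_[p]] (μ : Measure ℚ_[p])
    [IsFiniteMeasureOnCompacts μ] (r : ℝ) : μ {x : ℚ_[p] | ‖x‖ ≤ r} < ⊤ := by
  have : {x : ℚ_[p] | ‖x‖ ≤ r} = Metric.closedBall 0 r := by ext; simp
  rw [this]
  exact (isCompact_closedBall _ _).measure_lt_top

variable [MeasurableSpace ℚ_[p]] [BorelSpace ℚ_[p]]

theorem measurableSet_norm_sub_le (y : ℚ_[p]) (r : ℝ) :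
    MeasurableSet {x : ℚ_[p] | ‖x - y‖ ≤ r} :=
  measurableSet_le (by fun_prop) measurable_const

theorem measurableSet_norm_le (r : ℝ) : MeasurableSet {x : ℚ_[p] | ‖x‖ ≤ r} := by
  simpa using measurableSet_norm_sub_le (0 : ℚ_[p]) r

variable (μ : Measure ℚ_[p]) [μ.IsAddHaarMeasure]

theorem measure_norm_sub_le (y : ℚ_[p]) (r : ℝ) :
    μ {x : ℚ_[p] | ‖x - y‖ ≤ r} = μ {x : ℚ_[p] | ‖x‖ ≤ r} := by
  have : {x : ℚ_[p] | ‖x - y‖ ≤ r} = (fun x => x + -y) ⁻¹' {x : ℚ_[p] | ‖x‖ ≤ r} := by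
    ext x; simp [sub_eq_add_neg]
  rw [this, measure_preimage_add_right]

theorem measureReal_norm_le_succ (r : ℤ) :
    μ.real {x : ℚ_[p] | ‖x‖ ≤ (p : ℝ) ^ (r + 1)} =
      p * μ.real {x : ℚ_[p] | ‖x‖ ≤ (p : ℝ) ^ r} := by
  have hp := prime_cast_pos p
  have h : {x : ℚ_[p] | ‖x‖ ≤ (p : ℝ) ^ (r + 1)} = ⋃ i ∈ Finset.range p,
      {x : ℚ_[p] | ‖x - i * (p : ℚ_[p]) ^ (-(r + 1))‖ ≤ (p : ℝ) ^ r} := by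
    ext x
    simpa using norm_le_prime_zpow_succ_iff r x
  rw [h, measureReal_biUnion_finset (h := fun i _ => by
    rw [measure_norm_sub_le]; exact (measure_norm_le_lt_top μ _).ne)]
  · simp_rw [measureReal_def, measure_norm_sub_le]
    simp
  · intro i hi j hj hij
    rw [Function.onFun, Set.disjoint_left]
    intro x hx hx'
    apply hij
    have h1 := norm_sub_le_of_norm_le hx' hx
    have h2 : ((i : ℤ) - j : ℚ_[p]) * (p : ℚ_[p]) ^ (-(r + 1)) =
      x - j * (p : ℚ_[p]) ^ (-(r + 1)) - (x - i * (p : ℚ_[p]) ^ (-(r + 1))) := by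
      push_cast; ring
    rw [← h2, Padic.norm_le_pow_iff_norm_lt_pow_add_one, norm_mul, Padic.norm_p_zpow, neg_neg,
      mul_lt_iff_lt_one_left (by positivity)] at h1
    have h3 : ((p : ℤ)) ∣ (i : ℤ) - j := by
      rw [← Padic.norm_intCast_lt_one_iff (p := p)]
      exact_mod_cast h1
    have h4 := Int.eq_zero_of_abs_lt_dvd h3 (by
      simp only [Finset.coe_range, Set.mem_Iio] at hi hj
      rw [abs_lt]; omega)
    omega
  · exact fun i _ => measurableSet_norm_sub_le _ _

theorem measureReal_norm_le (hμ : μ {x : ℚ_[p] | ‖x‖ ≤ 1} = 1) (r : ℤ) :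
    μ.real {x : ℚ_[p] | ‖x‖ ≤ (p : ℝ) ^ r} = (p : ℝ) ^ r := by
  have hp := (prime_cast_pos p).ne'
  induction r using Int.induction_on with
  | zero => simp [measureReal_def, hμ]
  | succ r ih => rw [measureReal_norm_le_succ, ih, zpow_add_one₀ hp, mul_comm]
  | pred r ih =>
    have h := measureReal_norm_le_succ μ (-r - 1)
    rw [sub_add_cancel, ih] at h
    rw [zpow_sub_one₀ hp, eq_mul_inv_iff_mul_eq₀ hp, mul_comm]
    rw [zpow_sub_one₀ hp] at h
    exact h.symm

end Ball

section Rho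

variable {p : ℕ} [Fact p.Prime] {σ b t : ℝ}

theorem rho_eq_tsum (x : ℚ_[p]) :
    rho p σ b t x = ∑' r : ℤ,
      (heatMultiplier p σ b t r - heatMultiplier p σ b t (r + 1)) * ballDensity p r x := by
  refine tsum_congr fun r => ?_
  rw [heatMultiplier, heatMultiplier, ballDensity, mul_assoc]
  push_cast
  congr 1
  by_cases h : ‖x‖ ≤ (p : ℝ) ^ (-r) <;> simp [Set.indicator]

theorem rho_eq_of_norm_eq {x y : ℚ_[p]} (h : ‖x‖ = ‖y‖) : rho p σ b t x = rho p σ b t y := by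
  simp [rho, Set.indicator, h]

theorem hasSum_int_split {f : ℤ → ℝ} {A B : ℝ} (r : ℤ)
    (hA : HasSum (fun n : ℕ => f (r + n)) A) (hB : HasSum (fun n : ℕ => f (r - 1 - n)) B) :
    HasSum f (A + B) := by
  rw [← (Equiv.addLeft r).hasSum_iff]
  refine HasSum.of_nat_of_neg_add_one hA (hasSum_real_of_eq hB (fun n => ?_) rfl)
  simp only [Function.comp_apply, Equiv.coe_addLeft]
  congr 1
  ring

theorem ballDensity_of_le {r : ℤ} {x : ℚ_[p]} (h : ‖x‖ ≤ (p : ℝ) ^ (-r)) :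
    ballDensity p r x = (p : ℝ) ^ r :=
  Set.indicator_of_mem (s := {z : ℚ_[p] | ‖z‖ ≤ (p : ℝ) ^ (-r)}) h _

theorem ballDensity_of_not_le {r : ℤ} {x : ℚ_[p]} (h : ¬ ‖x‖ ≤ (p : ℝ) ^ (-r)) :
    ballDensity p r x = 0 :=
  Set.indicator_of_notMem (s := {z : ℚ_[p] | ‖z‖ ≤ (p : ℝ) ^ (-r)}) h _

theorem ballDensity_nonneg (r : ℤ) (x : ℚ_[p]) : 0 ≤ ballDensity p r x :=
  Set.indicator_nonneg (fun _ _ => zpow_nonneg (prime_cast_pos p).le _) _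

theorem zpow_sub_natCast_eq (r : ℤ) (n : ℕ) :
    (p : ℝ) ^ (r - n) = (p : ℝ) ^ r * (p : ℝ)⁻¹ ^ n := by
  rw [zpow_sub₀ (prime_cast_pos p).ne', zpow_natCast, inv_pow, div_eq_mul_inv]

theorem rho_of_norm_eq (hσ : 0 < σ) (ht : 0 < t) {r : ℤ} {x : ℚ_[p]}
    (hx : ‖x‖ = (p : ℝ) ^ (-r)) :
    rho p σ b t x =
      (p : ℝ) ^ r * (ballMass p σ b t r - heatMultiplier p σ b t (r + 1)) := by
  rw [rho_eq_tsum, ← zero_add ((p : ℝ) ^ r * _)]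
  refine (hasSum_int_split (r + 1) (hasSum_real_of_eq hasSum_zero (fun n => ?_) rfl)
    (hasSum_real_of_eq ((hasSum_ballMass_sub hσ ht r).mul_left ((p : ℝ) ^ r))
      (fun n => ?_) rfl)).tsum_eq
  · rw [ballDensity_of_not_le, mul_zero]
    rw [hx, prime_zpow_le_iff]
    omega
  · rw [add_sub_cancel_right, ballDensity_of_le, zpow_sub_natCast_eq]
    · ring
    · rw [hx, prime_zpow_le_iff]
      omega

variable [MeasurableSpace ℚ_[p]] [BorelSpace ℚ_[p]] (μ : Measure ℚ_[p]) [μ.IsAddHaarMeasure]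

theorem setIntegral_ballDensity (hμ : μ {x : ℚ_[p] | ‖x‖ ≤ 1} = 1) (q r : ℤ) :
    ∫ x in {x : ℚ_[p] | ‖x‖ ≤ (p : ℝ) ^ (-r)}, ballDensity p q x ∂μ =
      (p : ℝ) ^ (q - max q r) := by
  simp only [ballDensity]
  rw [setIntegral_indicator (measurableSet_norm_le _), setIntegral_const]
  have : {x : ℚ_[p] | ‖x‖ ≤ (p : ℝ) ^ (-r)} ∩ {x : ℚ_[p] | ‖x‖ ≤ (p : ℝ) ^ (-q)} =
      {x : ℚ_[p] | ‖x‖ ≤ (p : ℝ) ^ (-max q r)} := by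
    ext x
    rcases le_total q r with h | h
    · simp only [Set.mem_inter_iff, Set.mem_ofPred_eq, max_eq_right h, and_iff_left_iff_imp]
      exact fun hx => hx.trans (prime_zpow_le_iff.2 (neg_le_neg h))
    · simp only [Set.mem_inter_iff, Set.mem_ofPred_eq, max_eq_left h, and_iff_right_iff_imp]
      exact fun hx => hx.trans (prime_zpow_le_iff.2 (neg_le_neg h))
  rw [this, measureReal_norm_le μ hμ, smul_eq_mul, ← zpow_add₀ (prime_cast_pos p).ne']
  congr 1
  ring

theorem setIntegral_rho (hμ : μ {x : ℚ_[p] | ‖x‖ ≤ 1} = 1) (hσ : 0 < σ) (hb : 0 < b)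
    (ht : 0 < t) (r : ℤ) :
    ∫ x in {x : ℚ_[p] | ‖x‖ ≤ (p : ℝ) ^ (-r)}, rho p σ b t x ∂μ = ballMass p σ b t r := by
  have hsum : HasSum (fun q : ℤ =>
      (heatMultiplier p σ b t q - heatMultiplier p σ b t (q + 1)) * (p : ℝ) ^ (q - max q r))
      (ballMass p σ b t r) := by
    rw [← add_sub_cancel (heatMultiplier p σ b t (r + 1)) (ballMass p σ b t r)]
    refine hasSum_int_split (r + 1)
      (hasSum_real_of_eq (hasSum_heatMultiplier_sub hσ hb ht (r + 1)) (fun n => ?_) rfl)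
      (hasSum_real_of_eq (hasSum_ballMass_sub hσ ht r) (fun n => ?_) rfl)
    · rw [max_eq_left (by omega), sub_self, zpow_zero, mul_one]
    · rw [add_sub_cancel_right, max_eq_right (by omega), sub_sub_cancel_left, ← inv_zpow',
        zpow_natCast, mul_comm]
  have hterm (q : ℤ) : ∫ x in {x : ℚ_[p] | ‖x‖ ≤ (p : ℝ) ^ (-r)},
      (heatMultiplier p σ b t q - heatMultiplier p σ b t (q + 1)) * ballDensity p q x ∂μ =
      (heatMultiplier p σ b t q - heatMultiplier p σ b t (q + 1)) *
        (p : ℝ) ^ (q - max q r) := by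
    rw [integral_const_mul, setIntegral_ballDensity μ hμ]
  have hnonneg (q : ℤ) (x : ℚ_[p]) :
      0 ≤ (heatMultiplier p σ b t q - heatMultiplier p σ b t (q + 1)) * ballDensity p q x :=
    mul_nonneg (sub_nonneg.2 (heatMultiplier_strictAnti hσ hb ht (lt_add_one q)).le)
      (ballDensity_nonneg q x)
  have : IsFiniteMeasure (μ.restrict {x : ℚ_[p] | ‖x‖ ≤ (p : ℝ) ^ (-r)}) :=
    isFiniteMeasure_restrict.2 (measure_norm_le_lt_top μ _).ne
  have h := hasSum_integral_of_summable_integral_norm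
    (μ := μ.restrict {x : ℚ_[p] | ‖x‖ ≤ (p : ℝ) ^ (-r)})
    (F := fun (q : ℤ) x =>
      (heatMultiplier p σ b t q - heatMultiplier p σ b t (q + 1)) * ballDensity p q x)
    (fun q => ((integrable_const _).indicator (measurableSet_norm_le _)).const_mul _)
    (by simpa only [Real.norm_of_nonneg (hnonneg _ _), hterm] using hsum.summable)
  simp_rw [rho_eq_tsum]
  simp_rw [hterm] at h
  exact h.unique hsum

theorem setIntegral_rho_sub (hμ : μ {x : ℚ_[p] | ‖x‖ ≤ 1} = 1) (hσ : 0 < σ) (hb : 0 < b)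
    (ht : 0 < t) (r : ℤ) {y x₀ : ℚ_[p]} (h : ‖x₀ - y‖ ≤ (p : ℝ) ^ (-r)) :
    ∫ x in {x : ℚ_[p] | ‖x - y‖ ≤ (p : ℝ) ^ (-r)}, rho p σ b t (x - x₀) ∂μ =
      ballMass p σ b t r := by
  rw [← setIntegral_rho μ hμ hσ hb ht r, ← integral_indicator (measurableSet_norm_le _),
    ← integral_indicator (measurableSet_norm_sub_le _ _), 
    ← integral_sub_right_eq_self
      (Set.indicator {x : ℚ_[p] | ‖x‖ ≤ (p : ℝ) ^ (-r)} (rho p σ b t)) x₀]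
  congr 1
  ext x
  have : ‖x - y‖ ≤ (p : ℝ) ^ (-r) ↔ ‖x - x₀‖ ≤ (p : ℝ) ^ (-r) :=
    norm_le_iff_of_norm_sub_le (by simpa using h)
  simp only [Set.indicator, Set.mem_ofPred_eq, this]

theorem setIntegral_rho_sub_of_not_le (hμ : μ {x : ℚ_[p] | ‖x‖ ≤ 1} = 1) (r : ℤ)
    {y x₀ : ℚ_[p]} (h : ¬ ‖x₀ - y‖ ≤ (p : ℝ) ^ (-r)) :
    ∫ x in {x : ℚ_[p] | ‖x - y‖ ≤ (p : ℝ) ^ (-r)}, rho p σ b t (x - x₀) ∂μ =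
      (p : ℝ) ^ (-r) * rho p σ b t (x₀ - y) := by
  have (x : ℚ_[p]) (hx : x ∈ {x : ℚ_[p] | ‖x - y‖ ≤ (p : ℝ) ^ (-r)}) :
      rho p σ b t (x - x₀) = rho p σ b t (x₀ - y) := by
    apply rho_eq_of_norm_eq
    rw [Set.mem_ofPred_eq] at hx
    rw [norm_sub_rev]
    refine le_antisymm ?_ ?_
    · exact (norm_le_iff_of_norm_sub_le
        (by simpa [norm_sub_rev] using hx.trans (not_le.1 h).le)).2 le_rfl
    · by_contra! hlt
      have := norm_sub_le_of_norm_le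
        (x := x₀ - x) (y := y - x) (r := max ‖x₀ - x‖ ((p : ℝ) ^ (-r))) (le_max_left _ _)
        (by rw [norm_sub_rev]; exact hx.trans (le_max_right _ _))
      rw [sub_sub_sub_cancel_right] at this
      exact (max_lt hlt (not_le.1 h)).not_ge this
  rw [setIntegral_congr_fun (measurableSet_norm_sub_le _ _) this, setIntegral_const,
    measureReal_def, measure_norm_sub_le, ← measureReal_def, measureReal_norm_le μ hμ, smul_eq_mul]

end Rho

/-- A linear combination of the indicator function of the ball of radius `p^{-r₀}` centred at
`y` and of the differences of the normalized indicator functions of `N` consecutive smaller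
balls. -/
noncomputable def ballSum (p : ℕ) [Fact p.Prime] (r₀ : ℤ) (y : ℚ_[p]) (N : ℕ) (c : ℝ)
    (d : ℕ → ℝ) (x : ℚ_[p]) : ℝ :=
  c * ballDensity p r₀ (x - y) + ∑ i ∈ Finset.range N,
    d i * (ballDensity p (r₀ + i + 1) (x - y) - ballDensity p (r₀ + i) (x - y))

section Diagonalization

variable {p : ℕ} [Fact p.Prime] {σ b t : ℝ}

theorem ballSum_one (r₀ : ℤ) (y : ℚ_[p]) (N : ℕ) (x : ℚ_[p]) :
    ballSum p r₀ y N 1 (fun _ => 1) x = ballDensity p (r₀ + N) (x - y) := by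
  have h := Finset.sum_range_sub (fun i : ℕ => ballDensity p (r₀ + i) (x - y)) N
  push_cast at h
  simp only [ballSum, one_mul, add_assoc] at h ⊢
  rw [h]
  simp

theorem mul_ballSum (r₀ : ℤ) (y : ℚ_[p]) (N : ℕ) (q c : ℝ) (d : ℕ → ℝ) (x : ℚ_[p]) :
    q * ballSum p r₀ y N c d x = ballSum p r₀ y N (q * c) (fun i => q * d i) x := by
  simp only [ballSum, mul_add, Finset.mul_sum, mul_assoc]

theorem neg_le_sum_heatMultiplier_mul (hσ : 0 < σ) (hb : 0 < b) (ht : 0 < t) {r₀ : ℤ}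
    {x : ℚ_[p]} (hx : ‖x‖ ≤ (p : ℝ) ^ (-r₀)) (N : ℕ) :
    -(heatMultiplier p σ b t (r₀ + 1) * (p : ℝ) ^ r₀) ≤ ∑ i ∈ Finset.range N,
      heatMultiplier p σ b t (r₀ + i + 1) *
        (ballDensity p (r₀ + i + 1) x - ballDensity p (r₀ + i) x) := by
  suffices h : heatMultiplier p σ b t (r₀ + N + 1) * ballDensity p (r₀ + N) x -
      heatMultiplier p σ b t (r₀ + 1) * (p : ℝ) ^ r₀ ≤ ∑ i ∈ Finset.range N,
      heatMultiplier p σ b t (r₀ + i + 1) *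
        (ballDensity p (r₀ + i + 1) x - ballDensity p (r₀ + i) x) by
    have := mul_nonneg (heatMultiplier_pos (p := p) (σ := σ) (b := b) (t := t) (r₀ + N + 1)).le
      (ballDensity_nonneg (r₀ + N) x)
    linarith
  induction N with
  | zero => simp [ballDensity_of_le hx]
  | succ N ih =>
    have h := mul_le_mul_of_nonneg_right (heatMultiplier_strictAnti (p := p) hσ hb ht
      (lt_add_one (r₀ + N + 1))).le (ballDensity_nonneg (r₀ + N + 1) x)
    rw [Finset.sum_range_succ]
    push_cast
    rw [← add_assoc]
    linarith

theorem setIntegral_mul_ballDensity_sub [MeasurableSpace ℚ_[p]] [BorelSpace ℚ_[p]]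
    (μ : Measure ℚ_[p]) (f : ℚ_[p] → ℝ) {r₀ r : ℤ} (hr : r₀ ≤ r)
    {y : ℚ_[p]} (hy : ‖y‖ ≤ (p : ℝ) ^ (-r₀)) :
    ∫ x in {x : ℚ_[p] | ‖x‖ ≤ (p : ℝ) ^ (-r₀)}, f x * ballDensity p r (x - y) ∂μ =
      (p : ℝ) ^ r * ∫ x in {x : ℚ_[p] | ‖x - y‖ ≤ (p : ℝ) ^ (-r)}, f x ∂μ := by
  have hsub : {x : ℚ_[p] | ‖x - y‖ ≤ (p : ℝ) ^ (-r)} ⊆ {x : ℚ_[p] | ‖x‖ ≤ (p : ℝ) ^ (-r₀)} :=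
    fun x hx => (norm_le_iff_of_norm_sub_le
      (le_trans hx (prime_zpow_le_iff.2 (neg_le_neg hr)))).2 hy
  have hfun (x : ℚ_[p]) : f x * ballDensity p r (x - y) =
      Set.indicator {x : ℚ_[p] | ‖x - y‖ ≤ (p : ℝ) ^ (-r)} (fun x => (p : ℝ) ^ r * f x) x := by
    by_cases h : ‖x - y‖ ≤ (p : ℝ) ^ (-r)
    · rw [ballDensity_of_le h, Set.indicator_of_mem (by exact h), mul_comm]
    · rw [ballDensity_of_not_le h, Set.indicator_of_notMem (by exact h), mul_zero]
  simp_rw [hfun]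
  rw [setIntegral_indicator (measurableSet_norm_sub_le _ _), Set.inter_eq_right.2 hsub,
    integral_const_mul]

variable [MeasurableSpace ℚ_[p]] [BorelSpace ℚ_[p]] (μ : Measure ℚ_[p]) [μ.IsAddHaarMeasure]

theorem setIntegral_rho_mul_ballDensity_sub_ballDensity
    (hμ : μ {x : ℚ_[p] | ‖x‖ ≤ 1} = 1) (hσ : 0 < σ) (hb : 0 < b) (ht : 0 < t) (r : ℤ)
    (x₀ y : ℚ_[p]) :
    (p : ℝ) ^ (r + 1) *
          ∫ x in {x : ℚ_[p] | ‖x - y‖ ≤ (p : ℝ) ^ (-(r + 1))}, rho p σ b t (x - x₀) ∂μ -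
        (p : ℝ) ^ r * ∫ x in {x : ℚ_[p] | ‖x - y‖ ≤ (p : ℝ) ^ (-r)}, rho p σ b t (x - x₀) ∂μ =
      heatMultiplier p σ b t (r + 1) *
        (ballDensity p (r + 1) (x₀ - y) - ballDensity p r (x₀ - y)) := by
  have hp := (prime_cast_pos p).ne'
  by_cases h1 : ‖x₀ - y‖ ≤ (p : ℝ) ^ (-(r + 1))
  · have h2 : ‖x₀ - y‖ ≤ (p : ℝ) ^ (-r) := h1.trans (prime_zpow_le_iff.2 (by omega))
    rw [setIntegral_rho_sub μ hμ hσ hb ht _ h1, setIntegral_rho_sub μ hμ hσ hb ht _ h2,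
      ballDensity_of_le h1, ballDensity_of_le h2, ballMass_succ hσ ht, zpow_add_one₀ hp]
    field_simp
    ring
  rw [setIntegral_rho_sub_of_not_le μ hμ _ h1, ballDensity_of_not_le h1, ← mul_assoc,
    ← zpow_add₀ hp, add_neg_cancel, zpow_zero, one_mul]
  by_cases h2 : ‖x₀ - y‖ ≤ (p : ℝ) ^ (-r)
  · have h3 : ‖x₀ - y‖ = (p : ℝ) ^ (-r) := by
      refine le_antisymm h2 (not_lt.1 fun h => h1 ?_)
      rw [Padic.norm_lt_pow_iff_norm_le_pow_sub_one] at h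
      rwa [neg_add']
    rw [setIntegral_rho_sub μ hμ hσ hb ht _ h2, ballDensity_of_le h2, rho_of_norm_eq hσ ht h3]
    ring
  · rw [setIntegral_rho_sub_of_not_le μ hμ _ h2, ballDensity_of_not_le h2, ← mul_assoc,
      ← zpow_add₀ hp, add_neg_cancel, zpow_zero]
    ring

theorem integrableOn_rho_sub (hμ : μ {x : ℚ_[p] | ‖x‖ ≤ 1} = 1) (hσ : 0 < σ) (hb : 0 < b)
    (ht : 0 < t) {r : ℤ} {x₀ : ℚ_[p]} (h : ‖x₀‖ ≤ (p : ℝ) ^ (-r)) :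
    IntegrableOn (fun x => rho p σ b t (x - x₀)) {x : ℚ_[p] | ‖x‖ ≤ (p : ℝ) ^ (-r)} μ := by
  refine Integrable.of_integral_ne_zero ?_
  have := setIntegral_rho_sub μ hμ hσ hb ht r (y := 0) (x₀ := x₀) (by simpa using h)
  simp only [sub_zero] at this
  rw [this]
  exact (ballMass_pos hσ ht r).ne'

theorem integrableOn_rho_sub_mul_ballDensity (hμ : μ {x : ℚ_[p] | ‖x‖ ≤ 1} = 1) (hσ : 0 < σ)
    (hb : 0 < b) (ht : 0 < t) {r₀ : ℤ} {x₀ : ℚ_[p]} (h : ‖x₀‖ ≤ (p : ℝ) ^ (-r₀)) (r : ℤ)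
    (y : ℚ_[p]) :
    IntegrableOn (fun x => rho p σ b t (x - x₀) * ballDensity p r (x - y))
      {x : ℚ_[p] | ‖x‖ ≤ (p : ℝ) ^ (-r₀)} μ := by
  have hfun : (fun x => rho p σ b t (x - x₀) * ballDensity p r (x - y)) =
      Set.indicator {x : ℚ_[p] | ‖x - y‖ ≤ (p : ℝ) ^ (-r)}
        (fun x => rho p σ b t (x - x₀) * (p : ℝ) ^ r) := by
    ext x
    by_cases h : ‖x - y‖ ≤ (p : ℝ) ^ (-r)
    · rw [ballDensity_of_le h, Set.indicator_of_mem (by exact h)]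
    · rw [ballDensity_of_not_le h, Set.indicator_of_notMem (by exact h), mul_zero]
  rw [hfun]
  exact Integrable.indicator ((integrableOn_rho_sub μ hμ hσ hb ht h).mul_const _)
    (measurableSet_norm_sub_le _ _)

theorem setIntegral_rho_mul_ballSum (hμ : μ {x : ℚ_[p] | ‖x‖ ≤ 1} = 1) (hσ : 0 < σ)
    (hb : 0 < b) (ht : 0 < t) {r₀ : ℤ} {x₀ y : ℚ_[p]} (hx₀ : ‖x₀‖ ≤ (p : ℝ) ^ (-r₀))
    (hy : ‖y‖ ≤ (p : ℝ) ^ (-r₀)) (N : ℕ) (c : ℝ) (d : ℕ → ℝ) :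
    ∫ x in {x : ℚ_[p] | ‖x‖ ≤ (p : ℝ) ^ (-r₀)},
        rho p σ b t (x - x₀) * ballSum p r₀ y N c d x ∂μ =
      ballSum p r₀ y N (c * ballMass p σ b t r₀)
        (fun i => d i * heatMultiplier p σ b t (r₀ + i + 1)) x₀ := by
  have hint (r : ℤ) := integrableOn_rho_sub_mul_ballDensity μ hμ hσ hb ht hx₀ r y
  have hfun (x : ℚ_[p]) : rho p σ b t (x - x₀) * ballSum p r₀ y N c d x =
      c * (rho p σ b t (x - x₀) * ballDensity p r₀ (x - y)) + ∑ i ∈ Finset.range N,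
        d i * (rho p σ b t (x - x₀) * ballDensity p (r₀ + i + 1) (x - y) -
          rho p σ b t (x - x₀) * ballDensity p (r₀ + i) (x - y)) := by
    rw [ballSum, mul_add, Finset.mul_sum]
    congr 1
    · ring
    · exact Finset.sum_congr rfl fun i _ => by ring
  have hdiff (i : ℕ) (_ : i ∈ Finset.range N) :
      IntegrableOn (fun x => d i * (rho p σ b t (x - x₀) * ballDensity p (r₀ + i + 1) (x - y) -
        rho p σ b t (x - x₀) * ballDensity p (r₀ + i) (x - y)))
        {x : ℚ_[p] | ‖x‖ ≤ (p : ℝ) ^ (-r₀)} μ :=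
    ((hint _).sub (hint _)).const_mul _
  have hxy := norm_sub_le_of_norm_le hx₀ hy
  simp_rw [hfun]
  rw [integral_add ((hint r₀).const_mul c) (integrable_finsetSum _ hdiff),
    integral_finsetSum _ hdiff, integral_const_mul,
    setIntegral_mul_ballDensity_sub μ _ le_rfl hy, setIntegral_rho_sub μ hμ hσ hb ht _ hxy,
    ballSum, ballDensity_of_le hxy]
  congr 1
  · ring
  · refine Finset.sum_congr rfl fun i _ => ?_
    rw [integral_const_mul, integral_sub (hint _) (hint _),
      setIntegral_mul_ballDensity_sub μ _ (by omega) hy,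
      setIntegral_mul_ballDensity_sub μ _ (by omega) hy,
      setIntegral_rho_mul_ballDensity_sub_ballDensity μ hμ hσ hb ht, mul_assoc]

theorem iterInt_replicate_eq_ballSum (hμ : μ {x : ℚ_[p] | ‖x‖ ≤ 1} = 1) (hσ : 0 < σ)
    (hb : 0 < b) (ht : 0 < t) {r₀ : ℤ} {y : ℚ_[p]} (hy : ‖y‖ ≤ (p : ℝ) ^ (-r₀)) {N : ℕ}
    {c : ℝ} {d : ℕ → ℝ} {f : ℚ_[p] → ℝ}
    (hf : ∀ x : ℚ_[p], ‖x‖ ≤ (p : ℝ) ^ (-r₀) → f x = ballSum p r₀ y N c d x) (k : ℕ)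
    {x₀ : ℚ_[p]} (hx₀ : ‖x₀‖ ≤ (p : ℝ) ^ (-r₀)) :
    iterInt p σ b μ {x : ℚ_[p] | ‖x‖ ≤ (p : ℝ) ^ (-r₀)} f (List.replicate k t) x₀ =
      ballSum p r₀ y N (c * ballMass p σ b t r₀ ^ k)
        (fun i => d i * heatMultiplier p σ b t (r₀ + i + 1) ^ k) x₀ := by
  induction k generalizing x₀ with
  | zero => simp [iterInt, hf x₀ hx₀]
  | succ k ih =>
    rw [List.replicate_succ, iterInt, setIntegral_congr_fun (measurableSet_norm_le _)
      fun x hx => congrArg (rho p σ b t (x - x₀) * ·) (ih hx),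
      setIntegral_rho_mul_ballSum μ hμ hσ hb ht hx₀ hy]
    simp only [pow_succ, mul_assoc]

theorem setIntegral_rho_sub_eq_ballSum (hμ : μ {x : ℚ_[p] | ‖x‖ ≤ 1} = 1) (hσ : 0 < σ)
    (hb : 0 < b) (ht : 0 < t) {r₀ : ℤ} {x₀ y : ℚ_[p]} (hx₀ : ‖x₀‖ ≤ (p : ℝ) ^ (-r₀))
    (hy : ‖y‖ ≤ (p : ℝ) ^ (-r₀)) (N : ℕ) :
    (p : ℝ) ^ (r₀ + N) *
        ∫ x in {x : ℚ_[p] | ‖x - y‖ ≤ (p : ℝ) ^ (-(r₀ + N))}, rho p σ b t (x - x₀) ∂μ =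
      ballSum p r₀ y N (ballMass p σ b t r₀)
        (fun i => heatMultiplier p σ b t (r₀ + i + 1)) x₀ := by
  have h := setIntegral_rho_mul_ballSum μ hμ hσ hb ht hx₀ hy N 1 fun _ => 1
  simp_rw [ballSum_one, one_mul] at h
  rw [← h, setIntegral_mul_ballDensity_sub μ _ (by omega) hy]

end Diagonalization

/-- Let `m ≥ 1`, `t > 0`, `a ∈ ℤ`, `y ∈ B_a`, and let `n` be large enough
that `B_{−n}(y) = {z : |z−y| ≤ p^{−n}} ⊆ B_a`.  Then, with `z_0 := 0`,
`(∫_{B_a}⋯∫_{B_a}∫_{B_{−n}(y)} ∏_{j=1}^m ρ(t/m, z_j−z_{j−1}) dμ(z_m)⋯dμ(z_1))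
   / (∫_{B_a} ρ(t/m, w) dμ(w))^m  >  ∫_{B_{−n}(y)} ρ(t,z) dμ(z)`,
where `z_1,…,z_{m−1}` range over `B_a` and the innermost variable `z_m` over `B_{−n}(y)`.
Probabilistically: for a p-adic Brownian path started at `0`, the conditional probability
that `X_t ∈ B_{−n}(y)` given that the path lies in `B_a` at the times `t/m, 2t/m, …, t`
strictly exceeds the unconditional probability that `X_t ∈ B_{−n}(y)`. -/
theorem exit_prob_statement_17 (p : ℕ) [Fact p.Prime]
    [MeasurableSpace ℚ_[p]] [BorelSpace ℚ_[p]]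
    (μ : Measure ℚ_[p]) [μ.IsAddHaarMeasure]
    (hμ : μ {x : ℚ_[p] | ‖x‖ ≤ 1} = 1)
    (σ b : ℝ) (hσ : 0 < σ) (hb : 0 < b)
    (m : ℕ) (hm : 1 ≤ m) (t : ℝ) (ht : 0 < t)
    (a : ℤ) (y : ℚ_[p]) (hy : ‖y‖ ≤ (p : ℝ) ^ a)
    (n : ℕ)
    (hn : {z : ℚ_[p] | ‖z - y‖ ≤ (p : ℝ) ^ (-(n : ℤ))} ⊆ {x : ℚ_[p] | ‖x‖ ≤ (p : ℝ) ^ a}) :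
    iterInt p σ b μ {x : ℚ_[p] | ‖x‖ ≤ (p : ℝ) ^ a}
        (fun x0 => ∫ z in {z : ℚ_[p] | ‖z - y‖ ≤ (p : ℝ) ^ (-(n : ℤ))},
          rho p σ b (t / m) (z - x0) ∂μ)
        (List.replicate (m - 1) (t / m)) 0 /
      (∫ w in {w : ℚ_[p] | ‖w‖ ≤ (p : ℝ) ^ a}, rho p σ b (t / m) w ∂μ) ^ m >
      ∫ z in {z : ℚ_[p] | ‖z - y‖ ≤ (p : ℝ) ^ (-(n : ℤ))}, rho p σ b t z ∂μ := by
  have hp := prime_cast_pos p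
  have hm0 : m ≠ 0 := by omega
  have hs : 0 < t / m := div_pos ht (by exact_mod_cast hm)
  obtain ⟨r₀, rfl⟩ : ∃ r, a = -r := ⟨-a, (neg_neg a).symm⟩
  obtain ⟨N, hN⟩ : ∃ N : ℕ, (n : ℤ) = r₀ + N := by
    have hmem := @hn (y + (p : ℚ_[p]) ^ n) (by simp)
    have hnorm := norm_sub_le_of_norm_le hmem hy
    rw [add_sub_cancel_left, Padic.norm_p_pow, prime_zpow_le_iff] at hnorm
    exact ⟨(n - r₀).toNat, by omega⟩
  have h0 : ‖(0 : ℚ_[p])‖ ≤ (p : ℝ) ^ (-r₀) := by simpa using (zpow_pos hp (-r₀)).le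
  have hP : 0 < (p : ℝ) ^ (r₀ + (N : ℤ)) := zpow_pos hp _
  have hball {u : ℝ} (hu : 0 < u) (x₀ : ℚ_[p]) (hx₀ : ‖x₀‖ ≤ (p : ℝ) ^ (-r₀)) :
      ∫ z in {z : ℚ_[p] | ‖z - y‖ ≤ (p : ℝ) ^ (-(r₀ + N : ℤ))}, rho p σ b u (z - x₀) ∂μ =
        ((p : ℝ) ^ (r₀ + (N : ℤ)))⁻¹ * ballSum p r₀ y N (ballMass p σ b u r₀)
          (fun i => heatMultiplier p σ b u (r₀ + i + 1)) x₀ := by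
    rw [← setIntegral_rho_sub_eq_ballSum μ hμ hσ hb hu hx₀ hy N, inv_mul_cancel_left₀ hP.ne']
  have hright := hball ht 0 h0
  simp only [sub_zero] at hright
  rw [hN, hright, setIntegral_rho μ hμ hσ hb hs, iterInt_replicate_eq_ballSum μ hμ hσ hb hs hy
    (fun x hx => (hball hs x hx).trans (mul_ballSum _ _ _ _ _ _ _)) _ h0]
  simp only [mul_assoc, mul_pow_sub_one hm0, heatMultiplier_pow m hm0]
  rw [← mul_ballSum, mul_div_assoc, gt_iff_lt, mul_lt_mul_iff_right₀ (inv_pos.2 hP),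
    lt_div_iff₀ (pow_pos (ballMass_pos hσ hs r₀) m)]
  have hy' : ‖0 - y‖ ≤ (p : ℝ) ^ (-r₀) := norm_sub_le_of_norm_le h0 hy
  have hS := neg_le_sum_heatMultiplier_mul hσ hb ht hy' N
  have hD : 0 < (p : ℝ) ^ r₀ := zpow_pos hp _
  have he := heatMultiplier_pos (p := p) (σ := σ) (b := b) (t := t) (r₀ + 1)
  have hL : ballMass p σ b (t / m) r₀ ^ m ≤ 1 :=
    pow_le_one₀ (ballMass_pos hσ hs r₀).le (ballMass_lt_one hσ hs r₀).le
  have hkey := one_lt_ballMass_pow_mul (p := p) hσ hb ht m hm0 r₀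
  rw [one_add_div he.ne', mul_div_assoc', one_lt_div he] at hkey
  simp only [ballSum]
  rw [ballDensity_of_le hy']
  nlinarith [mul_le_mul_of_nonneg_right hS (sub_nonneg.2 hL), mul_lt_mul_of_pos_right hkey hD]
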